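/- arXiv:1201.4690 — 5 statements merged into one kernel-verified Lean document; each statement's English description precedes it below -/
import Mathlib

section
/- For Newtonian space-time data and all u, u', u'' ∈ V₁, the functionals σ satisfy: σ(u,u) = 0, σ(u',u) = −σ(u,u'), and σ(u,u') + σ(u',u'') = σ(u,u'') (the cocycle identity). -/
/-- Newtonian space-time data: the functional `σ(u,u') ∈ V*` associated with two
inertial frames `u, u' ∈ V₁ = {v : V | τ v = 1}`, given by
`σ(u,u')(v) = g (u - u') (v - τ(v)•(u+u')/2)`. -/
noncomputable def nsigma {V : Type*} [AddCommGroup V] [Module ℝ V]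
    (τ : V →ₗ[ℝ] ℝ)
    (g : LinearMap.ker τ →ₗ[ℝ] LinearMap.ker τ →ₗ[ℝ] ℝ)
    (u u' : {v : V // τ v = 1}) (v : V) : ℝ :=
  g ⟨u.1 - u'.1, by
      simp only [LinearMap.mem_ker, map_sub, u.2, u'.2]; ring⟩
    ⟨v - (τ v / 2) • (u.1 + u'.1), by
      simp only [LinearMap.mem_ker, map_sub, map_smul, map_add, u.2, u'.2, smul_eq_mul]; ring⟩

/-- For Newtonian space-time data and all `u, u', u'' ∈ V₁`:
`σ(u,u) = 0`, `σ(u',u) = −σ(u,u')`, and the cocycle identity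
`σ(u,u') + σ(u',u'') = σ(u,u'')`. -/
theorem stmt_11 {V : Type*} [AddCommGroup V] [Module ℝ V]
    (τ : V →ₗ[ℝ] ℝ) (hτ : τ ≠ 0)
    (g : LinearMap.ker τ →ₗ[ℝ] LinearMap.ker τ →ₗ[ℝ] ℝ)
    (hsymm : ∀ x y : LinearMap.ker τ, g x y = g y x)
    (u u' u'' : {v : V // τ v = 1}) :
    (∀ v : V, nsigma τ g u u v = 0) ∧
    (∀ v : V, nsigma τ g u' u v = - nsigma τ g u u' v) ∧
    (∀ v : V, nsigma τ g u u' v + nsigma τ g u' u'' v = nsigma τ g u u'' v) := by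
  have key : ∀ (u u' : {v : V // τ v = 1}) (v : V) (a p : LinearMap.ker τ),
      (a : V) = u.1 - u'.1 → (p : V) = v - τ v • u.1 →
      nsigma τ g u u' v = g a p + τ v / 2 * g a a := by
    intro u u' v a p ha hp
    rw [← smul_eq_mul, ← map_smul, ← map_add]
    refine congrArg₂ (fun x y => g x y) (Subtype.ext ha.symm) (Subtype.ext ?_)
    simp only [Submodule.coe_add, Submodule.coe_smul, ha, hp]
    module
  have hker : ∀ x y : {v : V // τ v = 1}, x.1 - y.1 ∈ LinearMap.ker τ := by
    intro x y
    simp [x.2, y.2]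
  have hproj : ∀ v : V, v - τ v • u.1 ∈ LinearMap.ker τ := by
    intro v
    simp [u.2]
  let a : LinearMap.ker τ := ⟨u.1 - u'.1, hker u u'⟩
  let b : LinearMap.ker τ := ⟨u'.1 - u''.1, hker u' u''⟩
  refine ⟨fun v => ?_, fun v => ?_, fun v => ?_⟩
  · rw [key u u v 0 ⟨_, hproj v⟩ (by simp) rfl]
    simp
  · let p : LinearMap.ker τ := ⟨_, hproj v⟩
    rw [key u u' v a p rfl rfl,
      key u' u v (-a) (p + τ v • a) (by simp [a])
        (by simp only [Submodule.coe_add, Submodule.coe_smul, a, p]; module)]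
    simp only [map_add, map_neg, map_smul, LinearMap.neg_apply, smul_eq_mul]
    ring
  · let p : LinearMap.ker τ := ⟨_, hproj v⟩
    rw [key u u' v a p rfl rfl,
      key u' u'' v b (p + τ v • a) rfl
        (by simp only [Submodule.coe_add, Submodule.coe_smul, a, p]; module),
      key u u'' v (a + b) p (by simp [a, b]) rfl]
    simp only [map_add, map_smul, LinearMap.add_apply, smul_eq_mul]
    rw [hsymm a b]
    ring
end

section
/- For Newtonian space-time data, the relation ∼ on V₁ × E × V* defined by (u,x,α) ∼ (u',x',α') if and only if x = x' and α' = α + m·σ(u,u') is an equivalence relation (reflexive, symmetric and transitive). -/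
/-- The relation `∼` on `V₁ × E × V*`:
`(u,x,α) ∼ (u',x',α')` iff `x = x'` and `α' = α + m·σ(u,u')`. -/
noncomputable def nrel {V : Type*} [AddCommGroup V] [Module ℝ V] (E : Type*)
    (τ : V →ₗ[ℝ] ℝ)
    (g : LinearMap.ker τ →ₗ[ℝ] LinearMap.ker τ →ₗ[ℝ] ℝ) (m : ℝ) :
    ({v : V // τ v = 1} × E × (V →ₗ[ℝ] ℝ)) →
      ({v : V // τ v = 1} × E × (V →ₗ[ℝ] ℝ)) → Prop :=
  fun p q => p.2.1 = q.2.1 ∧ ∀ v : V, q.2.2 v = p.2.2 v + m * nsigma τ g p.1 q.1 v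

theorem nsigma_self {V : Type*} [AddCommGroup V] [Module ℝ V] (τ : V →ₗ[ℝ] ℝ)
    (g : LinearMap.ker τ →ₗ[ℝ] LinearMap.ker τ →ₗ[ℝ] ℝ)
    (u : {v : V // τ v = 1}) (v : V) : nsigma τ g u u v = 0 := by
  have h : (⟨u.1 - u.1, by simp⟩ : LinearMap.ker τ) = 0 := Subtype.ext (sub_self _)
  simp only [nsigma, h, map_zero, LinearMap.zero_apply]

theorem nsigma_add {V : Type*} [AddCommGroup V] [Module ℝ V] (τ : V →ₗ[ℝ] ℝ)
    (g : LinearMap.ker τ →ₗ[ℝ] LinearMap.ker τ →ₗ[ℝ] ℝ)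
    (hsymm : ∀ x y : LinearMap.ker τ, g x y = g y x)
    (u₁ u₂ u₃ : {v : V // τ v = 1}) (v : V) :
    nsigma τ g u₁ u₂ v + nsigma τ g u₂ u₃ v = nsigma τ g u₁ u₃ v := by
  have mem (u u' : {v : V // τ v = 1}) : u.1 - u'.1 ∈ LinearMap.ker τ := by
    simp [u.2, u'.2]
  have memv : v - τ v • u₂.1 ∈ LinearMap.ker τ := by simp [u₂.2]
  let a : LinearMap.ker τ := ⟨u₁.1 - u₂.1, mem u₁ u₂⟩
  let b : LinearMap.ker τ := ⟨u₂.1 - u₃.1, mem u₂ u₃⟩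
  let w : LinearMap.ker τ := ⟨v - τ v • u₂.1, memv⟩
  have h₁₂ : nsigma τ g u₁ u₂ v = g a (w - (τ v / 2) • a) := by
    unfold nsigma
    congr 1
    apply Subtype.ext
    simp only [a, w, Submodule.coe_sub, Submodule.coe_smul]
    module
  have h₂₃ : nsigma τ g u₂ u₃ v = g b (w + (τ v / 2) • b) := by
    unfold nsigma
    congr 1
    apply Subtype.ext
    simp only [b, w, Submodule.coe_add, Submodule.coe_smul]
    module
  have h₁₃ : nsigma τ g u₁ u₃ v = g (a + b) (w - (τ v / 2) • a + (τ v / 2) • b) := by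
    unfold nsigma
    congr 1
    · congr 1
      apply Subtype.ext
      simp [a, b]
    · apply Subtype.ext
      simp only [a, b, w, Submodule.coe_sub, Submodule.coe_add, Submodule.coe_smul]
      module
  rw [h₁₂, h₂₃, h₁₃]
  simp only [map_add, map_sub, map_smul, LinearMap.add_apply, smul_eq_mul, hsymm b a]
  ring

/-- For Newtonian space-time data, the relation `∼` on
`V₁ × E × V*` is an equivalence relation. -/
theorem stmt_12 {V : Type*} [AddCommGroup V] [Module ℝ V] (E : Type*) [Nonempty E]
    (τ : V →ₗ[ℝ] ℝ) (hτ : τ ≠ 0)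
    (g : LinearMap.ker τ →ₗ[ℝ] LinearMap.ker τ →ₗ[ℝ] ℝ)
    (hsymm : ∀ x y : LinearMap.ker τ, g x y = g y x) (m : ℝ) :
    Equivalence (nrel E τ g m) := by
  refine ⟨fun p => ⟨rfl, fun v => ?_⟩, fun {p q} h => ⟨h.1.symm, fun v => ?_⟩,
    fun {p q r} h h' => ⟨h.1.trans h'.1, fun v => ?_⟩⟩
  · rw [nsigma_self, mul_zero, add_zero]
  · have hs := nsigma_add τ g hsymm p.1 q.1 p.1 v
    rw [nsigma_self] at hs
    rw [h.2 v, add_assoc, ← mul_add, hs, mul_zero, add_zero]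
  · rw [h'.2 v, h.2 v, add_assoc, ← mul_add, nsigma_add τ g hsymm]
end

section
/- For Newtonian space-time data: for all u, u' ∈ V₁ and all v ∈ V₀ one has σ(u,u')(v) = g(u − u', v); consequently, if (u,x,α) ∼ (u',x',α') in V₁ × E × V*, then (u,x,α|_{V₀}) ∼₀ (u',x',α'|_{V₀}) in V₁ × E × V₀*, so the assignment [(u,x,α)] ↦ [(u,x,α|_{V₀})] is a well-defined map μ : P → P₀. -/
/-- The relation `∼₀` on `V₁ × E × V₀*`:
`(u,x,ᾱ) ∼₀ (u',x',ᾱ')` iff `x = x'` and `ᾱ' = ᾱ + m·g(u − u', ·)`. -/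
noncomputable def nrel0 {V : Type*} [AddCommGroup V] [Module ℝ V] (E : Type*)
    (τ : V →ₗ[ℝ] ℝ)
    (g : LinearMap.ker τ →ₗ[ℝ] LinearMap.ker τ →ₗ[ℝ] ℝ) (m : ℝ) :
    ({v : V // τ v = 1} × E × (LinearMap.ker τ →ₗ[ℝ] ℝ)) →
      ({v : V // τ v = 1} × E × (LinearMap.ker τ →ₗ[ℝ] ℝ)) → Prop :=
  fun p q => p.2.1 = q.2.1 ∧
    ∀ w : LinearMap.ker τ,
      q.2.2 w = p.2.2 w +
        m * g ⟨p.1.1 - q.1.1, by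
          simp only [LinearMap.mem_ker, map_sub, p.1.2, q.1.2]; ring⟩ w

/-- Restriction `(u,x,α) ↦ (u,x,α|_{V₀})`. -/
def nrestr {V : Type*} [AddCommGroup V] [Module ℝ V] (E : Type*)
    (τ : V →ₗ[ℝ] ℝ)
    (p : {v : V // τ v = 1} × E × (V →ₗ[ℝ] ℝ)) :
    {v : V // τ v = 1} × E × (LinearMap.ker τ →ₗ[ℝ] ℝ) :=
  (p.1, p.2.1, p.2.2 ∘ₗ (LinearMap.ker τ).subtype)

theorem nsigma_of_mem_ker {V : Type*} [AddCommGroup V] [Module ℝ V]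
    (τ : V →ₗ[ℝ] ℝ)
    (g : LinearMap.ker τ →ₗ[ℝ] LinearMap.ker τ →ₗ[ℝ] ℝ)
    (u u' : {v : V // τ v = 1}) (v : V) (hv : τ v = 0) :
    nsigma τ g u u' v =
      g ⟨u.1 - u'.1, by
          simp only [LinearMap.mem_ker, map_sub, u.2, u'.2]; ring⟩
        ⟨v, LinearMap.mem_ker.mpr hv⟩ := by
  unfold nsigma
  congr 2
  simp [hv]

theorem nrel.nrestr {V : Type*} [AddCommGroup V] [Module ℝ V] {E : Type*}
    {τ : V →ₗ[ℝ] ℝ}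
    {g : LinearMap.ker τ →ₗ[ℝ] LinearMap.ker τ →ₗ[ℝ] ℝ} {m : ℝ}
    {p q : {v : V // τ v = 1} × E × (V →ₗ[ℝ] ℝ)} (h : nrel E τ g m p q) :
    nrel0 E τ g m (nrestr E τ p) (nrestr E τ q) := by
  refine ⟨h.1, fun w => (h.2 w).trans ?_⟩
  rw [nsigma_of_mem_ker τ g p.1 q.1 w w.2]
  rfl

/-- For Newtonian space-time data: `σ(u,u')(v) = g(u − u', v)`
for all `v ∈ V₀`; consequently `∼`-related triples have `∼₀`-related
restrictions, so `[(u,x,α)] ↦ [(u,x,α|_{V₀})]` is a well-defined map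
`μ : P → P₀`. -/
theorem stmt_13 {V : Type*} [AddCommGroup V] [Module ℝ V] (E : Type*) [Nonempty E]
    (τ : V →ₗ[ℝ] ℝ) (hτ : τ ≠ 0)
    (g : LinearMap.ker τ →ₗ[ℝ] LinearMap.ker τ →ₗ[ℝ] ℝ)
    (hsymm : ∀ x y : LinearMap.ker τ, g x y = g y x) (m : ℝ) :
    (∀ (u u' : {v : V // τ v = 1}) (v : V) (hv : τ v = 0),
      nsigma τ g u u' v =
        g ⟨u.1 - u'.1, by
            simp only [LinearMap.mem_ker, map_sub, u.2, u'.2]; ring⟩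
          ⟨v, LinearMap.mem_ker.mpr hv⟩) ∧
    (∀ p q : {v : V // τ v = 1} × E × (V →ₗ[ℝ] ℝ),
      nrel E τ g m p q → nrel0 E τ g m (nrestr E τ p) (nrestr E τ q)) ∧
    (∃! μmap : Quot (nrel E τ g m) → Quot (nrel0 E τ g m),
      ∀ p : {v : V // τ v = 1} × E × (V →ₗ[ℝ] ℝ),
        μmap (Quot.mk _ p) = Quot.mk _ (nrestr E τ p)) := by
  refine ⟨nsigma_of_mem_ker τ g, fun _ _ => nrel.nrestr,
    Quot.map (nrestr E τ) fun _ _ => nrel.nrestr, fun _ => rfl, fun f hf => ?_⟩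
  funext x
  induction x using Quot.ind with
  | mk p => exact hf p
end

section
/- For Newtonian space-time data, let L : V → V be a linear bijection such that τ ∘ L = τ and g(Lw, Lw') = g(w, w') for all w, w' ∈ V₀ (note that then L maps V₀ to V₀ and V₁ to V₁). Then for all u, u' ∈ V₁ one has σ(Lu, Lu') = σ(u,u') ∘ L⁻¹, i.e. σ(Lu,Lu')(v) = σ(u,u')(L⁻¹v) for every v ∈ V. -/
/-- For Newtonian space-time data, if `L : V → V` is a linear
bijection with `τ ∘ L = τ` which preserves `g` on `V₀`, then for all
`u, u' ∈ V₁` one has `σ(Lu, Lu') = σ(u,u') ∘ L⁻¹`. -/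
theorem stmt_15 {V : Type*} [AddCommGroup V] [Module ℝ V]
    (τ : V →ₗ[ℝ] ℝ) (hτ : τ ≠ 0)
    (g : LinearMap.ker τ →ₗ[ℝ] LinearMap.ker τ →ₗ[ℝ] ℝ)
    (hsymm : ∀ x y : LinearMap.ker τ, g x y = g y x)
    (L : V ≃ₗ[ℝ] V)
    (hτL : ∀ v : V, τ (L v) = τ v)
    (hgL : ∀ w w' : LinearMap.ker τ,
      g ⟨L w.1, by
          rw [LinearMap.mem_ker, hτL]; exact LinearMap.mem_ker.mp w.2⟩
        ⟨L w'.1, by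
          rw [LinearMap.mem_ker, hτL]; exact LinearMap.mem_ker.mp w'.2⟩ = g w w')
    (u u' : {v : V // τ v = 1}) :
    ∀ v : V,
      nsigma τ g ⟨L u.1, by rw [hτL]; exact u.2⟩ ⟨L u'.1, by rw [hτL]; exact u'.2⟩ v
        = nsigma τ g u u' (L.symm v) := by
  intro v
  obtain ⟨v, rfl⟩ := L.surjective v
  rw [L.symm_apply_apply]
  unfold nsigma
  refine Eq.trans ?_ (hgL _ _)
  congr 2
  · congr 1
    simp
  · simp [hτL]
end

section
/- Fix ν ∈ ℝ and let e₃ = (0,0,1) ∈ ℝ³. Let S = {(A,Π) ∈ SO(3) × ℝ³ : (AΠ)·e₃ = ν} and T = {(q,u) ∈ ℝ³ × ℝ³ : ‖q‖ = 1 and u·q = 0}. Define Φ(A,Π) = (A⁻¹e₃, (A⁻¹e₃) × Π). Then: (i) Φ maps S into T; (ii) Φ : S → T is surjective; (iii) for (A,Π), (B,Π') ∈ S, Φ(A,Π) = Φ(B,Π') if and only if Π = Π' and there exists R ∈ SO(3) with R·e₃ = e₃ and B = R·A. Consequently, Φ induces a bijection from the quotient of S by the action (A,Π) ↦ (RA,Π)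 of the subgroup {R ∈ SO(3) : R·e₃ = e₃} onto T (the set-level identification of the reduced phase space of the time-dependent heavy top with the cotangent bundle of the 2-sphere). -/
open Matrix

/-- The set of real 3×3 special orthogonal matrices. -/
def SO3 : Set (Matrix (Fin 3) (Fin 3) ℝ) := {A | Aᵀ * A = 1 ∧ A.det = 1}

/-- The vector `e₃ = (0,0,1) ∈ ℝ³`. -/
def e3 : Fin 3 → ℝ := ![0, 0, 1]

/-- The level set `S = {(A,Π) ∈ SO(3) × ℝ³ : (AΠ)·e₃ = ν}`. -/
def topS (ν : ℝ) : Set (Matrix (Fin 3) (Fin 3) ℝ × (Fin 3 → ℝ)) :=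
  {p | p.1 ∈ SO3 ∧ (p.1.mulVec p.2) ⬝ᵥ e3 = ν}

/-- `T = {(q,u) ∈ ℝ³ × ℝ³ : ‖q‖ = 1 and u·q = 0}` (the cotangent bundle of the
2-sphere; `‖q‖ = 1` is written as `q ⬝ᵥ q = 1`). -/
def topT : Set ((Fin 3 → ℝ) × (Fin 3 → ℝ)) :=
  {q | q.1 ⬝ᵥ q.1 = 1 ∧ q.2 ⬝ᵥ q.1 = 0}

/-- `Φ(A,Π) = (A⁻¹e₃, (A⁻¹e₃) × Π)`. -/
noncomputable def topPhi (p : Matrix (Fin 3) (Fin 3) ℝ × (Fin 3 → ℝ)) :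
    (Fin 3 → ℝ) × (Fin 3 → ℝ) :=
  (p.1⁻¹.mulVec e3, crossProduct (p.1⁻¹.mulVec e3) p.2)

/-- Orbit relation on `S` for the action `(A,Π) ↦ (RA,Π)` of the stabilizer of
`e₃` in `SO(3)`. -/
def topRel (ν : ℝ) : {p // p ∈ topS ν} → {p // p ∈ topS ν} → Prop :=
  fun p q => ∃ R : Matrix (Fin 3) (Fin 3) ℝ,
    R ∈ SO3 ∧ R.mulVec e3 = e3 ∧ q.1.1 = R * p.1.1 ∧ q.1.2 = p.1.2

theorem inv_eq_transpose_of_mem_SO3 {A : Matrix (Fin 3) (Fin 3) ℝ} (hA : A ∈ SO3) : A⁻¹ = Aᵀ :=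
  Matrix.inv_eq_left_inv hA.1

theorem mul_transpose_of_mem_SO3 {A : Matrix (Fin 3) (Fin 3) ℝ} (hA : A ∈ SO3) : A * Aᵀ = 1 :=
  mul_eq_one_comm.mp hA.1

theorem mul_transpose_mem_SO3 {A B : Matrix (Fin 3) (Fin 3) ℝ} (hA : A ∈ SO3) (hB : B ∈ SO3) :
    B * Aᵀ ∈ SO3 := by
  refine ⟨?_, by rw [det_mul, det_transpose, hA.2, hB.2, one_mul]⟩
  rw [transpose_mul, transpose_transpose, Matrix.mul_assoc, ← Matrix.mul_assoc Bᵀ, hB.1,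
    Matrix.one_mul, mul_transpose_of_mem_SO3 hA]

theorem e3_dotProduct_e3 : e3 ⬝ᵥ e3 = 1 := by
  simp [e3, dotProduct, Fin.sum_univ_three]

theorem inv_mulVec_e3_dotProduct_self {A : Matrix (Fin 3) (Fin 3) ℝ} (hA : A ∈ SO3) :
    (A⁻¹ *ᵥ e3) ⬝ᵥ (A⁻¹ *ᵥ e3) = 1 := by
  rw [inv_eq_transpose_of_mem_SO3 hA, dotProduct_mulVec, vecMul_transpose, mulVec_mulVec,
    mul_transpose_of_mem_SO3 hA, one_mulVec, e3_dotProduct_e3]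

theorem inv_mulVec_e3_dotProduct {A : Matrix (Fin 3) (Fin 3) ℝ} (hA : A ∈ SO3) (v : Fin 3 → ℝ) :
    (A⁻¹ *ᵥ e3) ⬝ᵥ v = (A *ᵥ v) ⬝ᵥ e3 := by
  rw [inv_eq_transpose_of_mem_SO3 hA, mulVec_transpose, ← dotProduct_mulVec, dotProduct_comm]

/-- Every unit vector is the image of `e₃` under the inverse of a rotation. -/
theorem exists_mem_SO3_inv_mulVec_e3 {q : Fin 3 → ℝ} (hq : q ⬝ᵥ q = 1) :
    ∃ A ∈ SO3, A⁻¹ *ᵥ e3 = q := by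
  suffices h : ∃ A ∈ SO3, Aᵀ *ᵥ e3 = q by
    obtain ⟨A, hA, h⟩ := h
    exact ⟨A, hA, by rw [inv_eq_transpose_of_mem_SO3 hA, h]⟩
  obtain ⟨x, y, z, rfl⟩ : ∃ x y z, q = ![x, y, z] :=
    ⟨q 0, q 1, q 2, by ext i; fin_cases i <;> rfl⟩
  have h : x ^ 2 + y ^ 2 + z ^ 2 = 1 := by
    simpa [dotProduct, Fin.sum_univ_three, sq] using hq
  by_cases hz : 1 + z = 0
  · have hz' : z = -1 := by linarith
    subst hz'
    have hx : x = 0 := by nlinarith [sq_nonneg x, sq_nonneg y]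
    have hy : y = 0 := by nlinarith [sq_nonneg x, sq_nonneg y]
    subst hx hy
    refine ⟨!![1, 0, 0; 0, -1, 0; 0, 0, -1], ⟨?_, ?_⟩, ?_⟩
    · ext i j
      fin_cases i <;> fin_cases j <;> simp [Matrix.mul_apply, Fin.sum_univ_three]
    · simp [det_fin_three]
    · ext i
      fin_cases i <;> simp [e3, mulVec, dotProduct, Fin.sum_univ_three]
  · obtain ⟨t, ht⟩ : ∃ t, t * (1 + z) = 1 := ⟨(1 + z)⁻¹, inv_mul_cancel₀ hz⟩
    have hs : t * (x ^ 2 + y ^ 2) = 1 - z := by linear_combination (1 - z) * ht + t * h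
    refine ⟨!![1 - t * x ^ 2, -(t * x * y), -x; -(t * x * y), 1 - t * y ^ 2, -y; x, y, z],
      ⟨?_, ?_⟩, ?_⟩
    · ext i j
      fin_cases i <;> fin_cases j <;> simp [Matrix.mul_apply, Fin.sum_univ_three]
      · linear_combination (t * x ^ 2) * hs - x ^ 2 * ht
      · linear_combination (t * x * y) * hs - x * y * ht
      · linear_combination x * hs
      · linear_combination (t * x * y) * hs - x * y * ht
      · linear_combination (t * y ^ 2) * hs - y ^ 2 * ht
      · linear_combination y * hs
      · linear_combination x * hs
      · linear_combination y * hs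
      · linear_combination h
    · simp [det_fin_three]
      linear_combination h - z * hs
    · ext i
      fin_cases i <;> simp [e3, mulVec, dotProduct, Fin.sum_univ_three]

theorem topPhi_mem_topT {p : Matrix (Fin 3) (Fin 3) ℝ × (Fin 3 → ℝ)} (hp : p.1 ∈ SO3) :
    topPhi p ∈ topT :=
  ⟨inv_mulVec_e3_dotProduct_self hp, by rw [dotProduct_comm]; exact dot_self_cross _ _⟩

theorem exists_mem_topS_topPhi_eq (ν : ℝ) {q : (Fin 3 → ℝ) × (Fin 3 → ℝ)} (hq : q ∈ topT) :
    ∃ p ∈ topS ν, topPhi p = q := by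
  obtain ⟨q, u⟩ := q
  obtain ⟨hq, hu⟩ : q ⬝ᵥ q = 1 ∧ u ⬝ᵥ q = 0 := hq
  obtain ⟨A, hA, rfl⟩ := exists_mem_SO3_inv_mulVec_e3 hq
  set q := A⁻¹ *ᵥ e3 with hqA
  refine ⟨(A, ν • q + crossProduct u q), ⟨hA, ?_⟩, Prod.ext rfl ?_⟩
  · change (A *ᵥ _) ⬝ᵥ e3 = ν
    rw [← inv_mulVec_e3_dotProduct hA, ← hqA, dotProduct_add, dotProduct_smul, hq,
      dot_cross_self, smul_eq_mul, mul_one, add_zero]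
  · change crossProduct q (ν • q + crossProduct u q) = u
    rw [map_add, map_smul, cross_self, cross_cross_eq_smul_sub_smul', hq, hu]
    simp

theorem topPhi_eq_iff {ν : ℝ} {p q : Matrix (Fin 3) (Fin 3) ℝ × (Fin 3 → ℝ)}
    (hp : p ∈ topS ν) (hq : q ∈ topS ν) :
    topPhi p = topPhi q ↔ p.2 = q.2 ∧ ∃ R ∈ SO3, R *ᵥ e3 = e3 ∧ q.1 = R * p.1 := by
  obtain ⟨A, v⟩ := p
  obtain ⟨B, w⟩ := q
  obtain ⟨hA, hv⟩ : A ∈ SO3 ∧ (A *ᵥ v) ⬝ᵥ e3 = ν := hp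
  obtain ⟨hB, hw⟩ : B ∈ SO3 ∧ (B *ᵥ w) ⬝ᵥ e3 = ν := hq
  constructor
  · intro h
    obtain ⟨h₁, h₂⟩ := Prod.ext_iff.mp h
    change A⁻¹ *ᵥ e3 = B⁻¹ *ᵥ e3 at h₁
    change crossProduct (A⁻¹ *ᵥ e3) v = crossProduct (B⁻¹ *ᵥ e3) w at h₂
    refine ⟨?_, B * Aᵀ, mul_transpose_mem_SO3 hA hB, ?_, ?_⟩
    · rw [← inv_mulVec_e3_dotProduct hA] at hv
      rw [← inv_mulVec_e3_dotProduct hB, ← h₁] at hw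
      have h₃ := congrArg (crossProduct (A⁻¹ *ᵥ e3)) h₂
      rw [← h₁, cross_cross_eq_smul_sub_smul', cross_cross_eq_smul_sub_smul', hv, hw,
        inv_mulVec_e3_dotProduct_self hA, one_smul, one_smul] at h₃
      exact sub_right_injective h₃
    · rw [← mulVec_mulVec, ← inv_eq_transpose_of_mem_SO3 hA, h₁,
        inv_eq_transpose_of_mem_SO3 hB, mulVec_mulVec, mul_transpose_of_mem_SO3 hB, one_mulVec]
    · change B = B * Aᵀ * A
      rw [Matrix.mul_assoc, hA.1, Matrix.mul_one]
  · rintro ⟨h, R, hR, hRe, hRA⟩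
    change v = w at h
    change B = R * A at hRA
    have h₁ : A⁻¹ *ᵥ e3 = B⁻¹ *ᵥ e3 := by
      rw [inv_eq_transpose_of_mem_SO3 hA, inv_eq_transpose_of_mem_SO3 hB, hRA, transpose_mul,
        ← mulVec_mulVec]
      nth_rewrite 2 [← hRe]
      rw [mulVec_mulVec e3 Rᵀ, hR.1, one_mulVec]
    simp only [topPhi, h₁, h]

/-- `Φ` maps `S` into `T`, surjectively, with
`Φ(A,Π) = Φ(B,Π')` iff `Π = Π'` and `B = R·A` for some `R ∈ SO(3)` fixing `e₃`;
consequently `Φ` induces a bijection from the quotient of `S` by the stabilizer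
action onto `T`. -/
theorem stmt_17 (ν : ℝ) :
    (∀ p ∈ topS ν, topPhi p ∈ topT) ∧
    (∀ q ∈ topT, ∃ p ∈ topS ν, topPhi p = q) ∧
    (∀ p q : Matrix (Fin 3) (Fin 3) ℝ × (Fin 3 → ℝ), p ∈ topS ν → q ∈ topS ν →
      (topPhi p = topPhi q ↔
        p.2 = q.2 ∧ ∃ R ∈ SO3, R.mulVec e3 = e3 ∧ q.1 = R * p.1)) ∧
    (∃ Ψ : Quot (topRel ν) → {q // q ∈ topT},
      (∀ p : {p // p ∈ topS ν}, (Ψ (Quot.mk _ p)).1 = topPhi p.1) ∧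
      Function.Bijective Ψ) := by
  refine ⟨fun p hp => topPhi_mem_topT hp.1, fun q hq => exists_mem_topS_topPhi_eq ν hq,
    fun p q hp hq => topPhi_eq_iff hp hq, ?_⟩
  refine ⟨Quot.lift (fun p => ⟨topPhi p.1, topPhi_mem_topT p.2.1⟩) ?_, fun p => rfl, ?_, ?_⟩
  · rintro p q ⟨R, hR, hRe, hRA, h⟩
    exact Subtype.ext ((topPhi_eq_iff p.2 q.2).mpr ⟨h.symm, R, hR, hRe, hRA⟩)
  · rintro ⟨p⟩ ⟨q⟩ h
    obtain ⟨h, R, hR, hRe, hRA⟩ := (topPhi_eq_iff p.2 q.2).mp (congrArg Subtype.val h)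
    exact Quot.sound ⟨R, hR, hRe, hRA, h.symm⟩
  · rintro ⟨q, hq⟩
    obtain ⟨p, hp, h⟩ := exists_mem_topS_topPhi_eq ν hq
    exact ⟨Quot.mk _ ⟨p, hp⟩, Subtype.ext h⟩
end
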